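/- arXiv:1801.04475 — 8 statements merged into one kernel-verified Lean document; each statement's English description precedes it below -/
import Mathlib

section
/- (B. Baumslag's theorem.) A group G is fully residually free if and only if G is residually free and commutative transitive. -/
open scoped commutatorElement

namespace FreeGroup

variable {α : Type*}

/-- A free group with a nontrivial central element has at most one free generator. -/
theorem subsingleton_of_forall_commute {x : FreeGroup α} (hx : x ≠ 1)
    (hc : ∀ y, Commute x y) : Subsingleton α := by
  classical
  by_contra hα
  rw [not_subsingleton_iff_nontrivial] at hα
  obtain ⟨p, L, hL⟩ : ∃ p L, x.toWord = p :: L :=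
    List.exists_cons_of_ne_nil (mt toWord_eq_nil_iff.1 hx)
  obtain ⟨a, ha⟩ := exists_ne p.1
  have hred : IsReduced ((a, true) :: p :: L) := by
    have h : IsReduced (p :: L) := hL ▸ isReduced_toWord
    exact List.isChain_cons_cons.2 ⟨fun h' => absurd h' ha, h⟩
  have hleft : (of a * x).toWord = (a, true) :: p :: L := by
    rw [toWord_mul, toWord_of, hL]
    exact hred.reduce_eq
  have hright : (x * of a).toWord = reduce (p :: L ++ [(a, true)]) := by
    rw [toWord_mul, toWord_of, hL]
  have heq : reduce (p :: L ++ [(a, true)]) = (a, true) :: p :: L := by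
    rw [← hleft, ← hright, (hc (of a)).eq]
  have hsub : reduce (p :: L ++ [(a, true)]) = p :: L ++ [(a, true)] :=
    (Red.sublist reduce.red).eq_of_length (by rw [heq]; simp)
  rw [hsub, List.cons_append] at heq
  exact ha (by rw [(List.cons.inj heq).1])

end FreeGroup

/-- A free group with a nontrivial central element is infinite cyclic. -/
theorem IsFreeGroup.nonempty_mulEquiv_int_of_forall_commute {F : Type*} [Group F] [IsFreeGroup F]
    {x : F} (hx : x ≠ 1) (hc : ∀ y, Commute x y) : Nonempty (F ≃* Multiplicative ℤ) := by
  let e := IsFreeGroup.toFreeGroup F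
  have hex : e x ≠ 1 := (map_ne_one_iff e e.injective).2 hx
  have : Subsingleton (IsFreeGroup.Generators F) :=
    FreeGroup.subsingleton_of_forall_commute hex fun y => by
      simpa using (hc (e.symm y)).map e
  rcases isEmpty_or_nonempty (IsFreeGroup.Generators F) with _ | ⟨⟨a⟩⟩
  · exact absurd (Subsingleton.elim _ _) hex
  · have : Unique (IsFreeGroup.Generators F) := uniqueOfSubsingleton a
    exact ⟨e.trans FreeGroup.mulEquivIntOfUnique⟩

namespace FreeGroup

variable {α : Type*} {x y z : FreeGroup α}

theorem nonempty_centralizer_mulEquiv_int (hx : x ≠ 1) :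
    Nonempty (Subgroup.centralizer {x} ≃* Multiplicative ℤ) :=
  IsFreeGroup.nonempty_mulEquiv_int_of_forall_commute
    (x := ⟨x, Subgroup.mem_centralizer_singleton_iff.2 rfl⟩)
    (fun h => hx (congrArg Subtype.val h))
    fun y => Subtype.ext (Subgroup.mem_centralizer_singleton_iff.1 y.2).symm

/-- Free groups are commutative transitive. -/
theorem commute_of_commute_of_commute (hx : x ≠ 1) (hy : Commute x y) (hz : Commute x z) :
    Commute y z := by
  obtain ⟨e⟩ := nonempty_centralizer_mulEquiv_int hx
  let y' : Subgroup.centralizer {x} := ⟨y, Subgroup.mem_centralizer_singleton_iff.2 hy.eq.symm⟩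
  let z' : Subgroup.centralizer {x} := ⟨z, Subgroup.mem_centralizer_singleton_iff.2 hz.eq.symm⟩
  have h : y' * z' = z' * y' := e.injective (by rw [_root_.map_mul, _root_.map_mul, mul_comm])
  exact congrArg Subtype.val h

theorem exists_commute_iff_mem_zpowers (hx : x ≠ 1) :
    ∃ c : FreeGroup α, ∀ y, Commute x y ↔ y ∈ Subgroup.zpowers c := by
  obtain ⟨e⟩ := nonempty_centralizer_mulEquiv_int hx
  have : IsCyclic (Subgroup.centralizer {x}) := isCyclic_of_surjective e.symm e.symm.surjective
  obtain ⟨c, hc⟩ := IsCyclic.exists_generator (α := Subgroup.centralizer {x})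
  refine ⟨c, fun y => ⟨fun hy => ?_, ?_⟩⟩
  · obtain ⟨n, hn⟩ := hc ⟨y, Subgroup.mem_centralizer_singleton_iff.2 hy.eq.symm⟩
    exact ⟨n, congrArg Subtype.val hn⟩
  · rintro ⟨n, rfl⟩
    have h : Commute x c := (Subgroup.mem_centralizer_singleton_iff.1 c.2).symm
    exact h.zpow_right n

/-- In a free group, an element commuting with its conjugate by `z` commutes with `z`. -/
theorem commute_of_commute_conj (h : Commute x (z * x * z⁻¹)) : Commute x z := by
  by_cases hx : x = 1
  · exact hx ▸ Commute.one_left z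
  by_cases hz : z = 1
  · exact hz ▸ Commute.one_right x
  obtain ⟨c, hc⟩ := exists_commute_iff_mem_zpowers hx
  have hxc : Commute x c := (hc c).2 (Subgroup.mem_zpowers c)
  have hc1 : c ≠ 1 := by
    rintro rfl
    exact hx (by simpa using (hc x).1 (Commute.refl x))
  have hxz : z * x * z⁻¹ ≠ 1 := fun h => hx (by simpa using h)
  have hconj : Commute (z * x * z⁻¹) (z * c * z⁻¹) := by
    simpa using hxc.map (MulAut.conj z)
  have hinv : Commute x (z⁻¹ * x * z) := by
    have := (h.map (MulAut.conj z⁻¹)).symm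
    simpa [mul_assoc] using this
  have hxz' : z⁻¹ * x * z ≠ 1 := fun h => hx (by simpa [mul_assoc, inv_mul_eq_one] using h)
  have hconj' : Commute (z⁻¹ * x * z) (z⁻¹ * c * z) := by
    simpa using hxc.map (MulAut.conj z⁻¹)
  obtain ⟨n, hn⟩ := (hc _).1 (commute_of_commute_of_commute hxz h.symm hconj)
  obtain ⟨m, hm⟩ := (hc _).1 (commute_of_commute_of_commute hxz' hinv.symm hconj')
  have hmn : m * n = 1 := by
    have h1 : c ^ (m * n) = c := by
      have : (z * c * z⁻¹) ^ m = z * c ^ m * z⁻¹ := by rw [conj_zpow]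
      rw [mul_comm, zpow_mul]
      simp only at hn hm
      rw [hn, this, hm]
      group
    have h2 : c ^ (m * n - 1) = 1 := by rw [zpow_sub_one, h1, mul_inv_cancel]
    have := (IsMulTorsionFree.zpow_eq_one_iff_right hc1).1 h2
    omega
  have hcz : Commute c z := by
    rcases Int.eq_one_or_neg_one_of_mul_eq_one' hmn with ⟨-, rfl⟩ | ⟨-, rfl⟩
    · have : c * z = z * c := by simpa [eq_mul_inv_iff_mul_eq] using hn
      exact this
    · have hzc : z * c * z⁻¹ = c⁻¹ := by simpa using hn.symm
      have hsq : Commute (z ^ 2) c := by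
        have h2 : z * (z * c * z⁻¹) * z⁻¹ = c := by
          calc z * (z * c * z⁻¹) * z⁻¹ = z * c⁻¹ * z⁻¹ := by rw [hzc]
            _ = (z * c * z⁻¹)⁻¹ := by group
            _ = c := by rw [hzc, inv_inv]
        have h3 : z * z * c = c * (z * z) := by
          nth_rewrite 2 [← h2]
          group
        rw [pow_two]
        exact h3
      have hz2 : z ^ 2 ≠ 1 := fun h => hz (pow_left_injective two_ne_zero (by simpa using h))
      exact commute_of_commute_of_commute hz2 hsq ((Commute.refl z).pow_left 2)
  exact commute_of_commute_of_commute hc1 hxc.symm hcz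

end FreeGroup

section ResiduallyFree

variable {G : Type} [Group G]

/-- In a commutative group, elements that survive in a free group survive in `ℤ`. -/
theorem exists_hom_int_ne_one (hG : ∀ a b : G, Commute a b) {S : Type} (φ : G →* FreeGroup S)
    {g : G} (hg : φ g ≠ 1) : ∃ ψ : G →* Multiplicative ℤ, ψ g ≠ 1 := by
  have hg' : φ.rangeRestrict g ≠ 1 := fun h => hg (congrArg Subtype.val h)
  obtain ⟨e⟩ := IsFreeGroup.nonempty_mulEquiv_int_of_forall_commute hg' fun y => by
    obtain ⟨b, rfl⟩ := φ.rangeRestrict_surjective y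
    exact (hG g b).map φ.rangeRestrict
  exact ⟨e.toMonoidHom.comp φ.rangeRestrict, (map_ne_one_iff e e.injective).2 hg'⟩

theorem exists_hom_int_forall_ne_one (T : Finset G)
    (hT : ∀ g ∈ T, ∃ ψ : G →* Multiplicative ℤ, ψ g ≠ 1) :
    ∃ ψ : G →* Multiplicative ℤ, ∀ g ∈ T, ψ g ≠ 1 := by
  classical
  induction T using Finset.induction_on with
  | empty => exact ⟨1, by simp⟩
  | insert a T _ ih =>
    obtain ⟨φ, hφ⟩ := ih fun g hg => hT g (Finset.mem_insert_of_mem hg)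
    obtain ⟨ψ, hψ⟩ := hT a (Finset.mem_insert_self a T)
    have hfin : (⋃ g ∈ insert a T, {n : ℤ | (φ * ψ ^ n) g = 1}).Finite := by
      refine (insert a T).finite_toSet.biUnion fun g hg => Set.Subsingleton.finite ?_
      intro m hm n hn
      have hm' : φ g * ψ g ^ m = 1 := hm
      have hn' : φ g * ψ g ^ n = 1 := hn
      by_cases h : ψ g = 1
      · rcases Finset.mem_insert.1 hg with rfl | hg
        · exact absurd h hψ
        · exact absurd (by simpa [h] using hm') (hφ g hg)
      · have h0 : ψ g ^ (m - n) = 1 := by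
          rw [zpow_sub, mul_inv_eq_one]
          exact mul_left_cancel (hm'.trans hn'.symm)
        have := (IsMulTorsionFree.zpow_eq_one_iff_right h).1 h0
        omega
    obtain ⟨n, hn⟩ := hfin.exists_notMem
    refine ⟨φ * ψ ^ n, fun g hg h => hn ?_⟩
    exact Set.mem_biUnion (Finset.mem_coe.2 hg) h

/-- In a residually free, commutative transitive, noncommutative group, any two nontrivial elements
have noncommuting conjugates. -/
theorem exists_not_commute_conj
    (hres : ∀ g : G, g ≠ 1 → ∃ (S : Type) (φ : G →* FreeGroup S), φ g ≠ 1)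
    (hct : ∀ g h f : G, g ≠ 1 → Commute g h → Commute g f → Commute h f)
    (hG : ¬ ∀ a b : G, Commute a b) {x y : G} (hx : x ≠ 1) (hy : y ≠ 1) :
    ∃ z, ¬ Commute x (z * y * z⁻¹) := by
  by_contra! h
  have hcentral : ∀ z, Commute y z := by
    intro z
    by_contra hyz
    obtain ⟨S, φ, hφ⟩ := hres ⁅y, z⁆ (mt commutatorElement_eq_one_iff_commute.1 hyz)
    rw [map_commutatorElement, Ne, commutatorElement_eq_one_iff_commute] at hφ
    have hconj : Commute y (z * y * z⁻¹) := hct x _ _ hx (by simpa using h 1) (h z)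
    exact hφ (FreeGroup.commute_of_commute_conj (by simpa using hconj.map φ))
  exact hG fun a b => hct y a b hy (hcentral a) (hcentral b)

/-- In a residually free, commutative transitive, noncommutative group, the nontriviality of the
images of finitely many nontrivial elements is implied by that of a single one. -/
theorem exists_ne_one_forall_hom_ne_one
    (hres : ∀ g : G, g ≠ 1 → ∃ (S : Type) (φ : G →* FreeGroup S), φ g ≠ 1)
    (hct : ∀ g h f : G, g ≠ 1 → Commute g h → Commute g f → Commute h f)
    (hG : ¬ ∀ a b : G, Commute a b) (T : Finset G) (hT : ∀ g ∈ T, g ≠ 1) :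
    ∃ y : G, y ≠ 1 ∧ ∀ (S : Type) (φ : G →* FreeGroup S), φ y ≠ 1 → ∀ g ∈ T, φ g ≠ 1 := by
  classical
  induction T using Finset.induction_on with
  | empty =>
    push Not at hG
    obtain ⟨a, b, hab⟩ := hG
    exact ⟨⁅a, b⁆, mt commutatorElement_eq_one_iff_commute.1 hab, by simp⟩
  | insert x T _ ih =>
    obtain ⟨y, hy, hyT⟩ := ih fun g hg => hT g (Finset.mem_insert_of_mem hg)
    obtain ⟨z, hz⟩ := exists_not_commute_conj hres hct hG (hT x (Finset.mem_insert_self x T)) hy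
    refine ⟨⁅x, z * y * z⁻¹⁆, mt commutatorElement_eq_one_iff_commute.1 hz, fun S φ hφ g hg => ?_⟩
    rcases Finset.mem_insert.1 hg with rfl | hg
    · exact fun h => hφ (by simp [map_commutatorElement, h])
    · exact hyT S φ (fun h => hφ (by simp [map_commutatorElement, h])) g hg

theorem exists_hom_freeGroup_forall_ne_one
    (hres : ∀ g : G, g ≠ 1 → ∃ (S : Type) (φ : G →* FreeGroup S), φ g ≠ 1)
    (hct : ∀ g h f : G, g ≠ 1 → Commute g h → Commute g f → Commute h f)
    (T : Finset G) (hT : ∀ g ∈ T, g ≠ 1) :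
    ∃ (S : Type) (φ : G →* FreeGroup S), ∀ g ∈ T, φ g ≠ 1 := by
  by_cases hG : ∀ a b : G, Commute a b
  · obtain ⟨ψ, hψ⟩ := exists_hom_int_forall_ne_one T fun g hg => by
      obtain ⟨S, φ, hφ⟩ := hres g (hT g hg)
      exact exists_hom_int_ne_one hG φ hφ
    let e : Multiplicative ℤ ≃* FreeGroup Unit := FreeGroup.mulEquivIntOfUnique.symm
    exact ⟨Unit, e.toMonoidHom.comp ψ, fun g hg => (map_ne_one_iff e e.injective).2 (hψ g hg)⟩
  · obtain ⟨y, hy, hyT⟩ := exists_ne_one_forall_hom_ne_one hres hct hG T hT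
    obtain ⟨S, φ, hφ⟩ := hres y hy
    exact ⟨S, φ, hyT S φ hφ⟩

/-- If finite families of distinct elements can be kept distinct in free groups, then two nontrivial
elements can be kept nontrivial simultaneously. -/
theorem exists_hom_freeGroup_ne_one_and_ne_one
    (hfull : ∀ (n : ℕ) (g : Fin n → G), Function.Injective g →
      ∃ (S : Type) (φ : G →* FreeGroup S), Function.Injective (φ ∘ g))
    {a b : G} (ha : a ≠ 1) (hb : b ≠ 1) :
    ∃ (S : Type) (φ : G →* FreeGroup S), φ a ≠ 1 ∧ φ b ≠ 1 := by
  classical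
  let T : Finset G := {1, a, b}
  obtain ⟨S, φ, hφ⟩ := hfull T.card (fun i => T.equivFin.symm i)
    (Subtype.val_injective.comp T.equivFin.symm.injective)
  have hinj : Set.InjOn φ T := fun u hu v hv huv => by
    have := @hφ (T.equivFin ⟨u, hu⟩) (T.equivFin ⟨v, hv⟩) (by simpa using huv)
    simpa using this
  refine ⟨S, φ, fun h => ha ?_, fun h => hb ?_⟩
  · exact hinj (by simp [T]) (by simp [T]) (h.trans (map_one φ).symm)
  · exact hinj (by simp [T]) (by simp [T]) (h.trans (map_one φ).symm)

end ResiduallyFree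

/-- B. Baumslag's theorem: a group is fully residually free if and only if it is
residually free and commutative transitive. -/
theorem fully_residually_free_iff_residually_free_and_commTrans (G : Type) [Group G] :
    (∀ (n : ℕ) (g : Fin n → G), Function.Injective g →
      ∃ (S : Type) (φ : G →* FreeGroup S), Function.Injective (φ ∘ g)) ↔
    ((∀ g : G, g ≠ 1 → ∃ (S : Type) (φ : G →* FreeGroup S), φ g ≠ 1) ∧
      (∀ g h f : G, g ≠ 1 → h ≠ 1 → f ≠ 1 →
        g * h = h * g → g * f = f * g → h * f = f * h)) := by
  classical
  refine ⟨fun hfull => ⟨fun g hg => ?_, fun g h f hg _ _ hgh hgf => ?_⟩,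
    fun ⟨hres, hct⟩ n g hg => ?_⟩
  · obtain ⟨S, φ, hφ, -⟩ := exists_hom_freeGroup_ne_one_and_ne_one hfull hg hg
    exact ⟨S, φ, hφ⟩
  · by_contra hhf
    obtain ⟨S, φ, hφ, hφ'⟩ := exists_hom_freeGroup_ne_one_and_ne_one hfull hg
      (mt commutatorElement_eq_one_iff_mul_comm.1 hhf)
    rw [map_commutatorElement, Ne, commutatorElement_eq_one_iff_commute] at hφ'
    exact hφ' (FreeGroup.commute_of_commute_of_commute hφ
      (Commute.map (show Commute g h from hgh) φ) (Commute.map (show Commute g f from hgf) φ))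
  · have hct' : ∀ a b c : G, a ≠ 1 → Commute a b → Commute a c → Commute b c := by
      intro a b c ha hab hac
      by_cases hb : b = 1
      · exact hb ▸ Commute.one_left c
      by_cases hc : c = 1
      · exact hc ▸ Commute.one_right b
      exact hct a b c ha hb hc hab hac
    obtain ⟨S, φ, hφ⟩ := exists_hom_freeGroup_forall_ne_one hres hct'
      (Finset.univ.offDiag.image fun p : Fin n × Fin n => g p.1 * (g p.2)⁻¹) (by
        simp only [Finset.mem_image, Finset.mem_offDiag]
        rintro _ ⟨p, ⟨-, -, hp⟩, rfl⟩ h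
        exact hp (hg (mul_inv_eq_one.1 h)))
    refine ⟨S, φ, fun i j hij => ?_⟩
    by_contra hne
    refine hφ (g i * (g j)⁻¹) (Finset.mem_image.2 ⟨(i, j), by simpa using hne, rfl⟩) ?_
    rw [map_mul, map_inv, mul_inv_eq_one]
    exact hij
end

section
/- Let C be a class of groups such that every group in C is commutative transitive. If a group G is fully residually-C, then G is commutative transitive. -/
/-- A family of homomorphisms separating the terms of every injective finite sequence contains
one that is injective on any given finite set. -/
theorem exists_monoidHom_injOn_finset (C : (H : Type) → Group H → Prop) (G : Type) [Group G]
    (hfr : ∀ (n : ℕ) (g : Fin n → G), Function.Injective g →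
      ∃ (H : Type) (instH : Group H) (φ : G →* H), C H instH ∧ Function.Injective (φ ∘ g))
    (S : Finset G) :
    ∃ (H : Type) (instH : Group H) (φ : G →* H), C H instH ∧ Set.InjOn φ S := by
  obtain ⟨H, instH, φ, hH, hφ⟩ := hfr S.card (fun i => (S.equivFin.symm i : G))
    (Subtype.val_injective.comp S.equivFin.symm.injective)
  refine ⟨H, instH, φ, hH, fun x hx y hy hxy => ?_⟩
  have key := @hφ (S.equivFin ⟨x, hx⟩) (S.equivFin ⟨y, hy⟩) (by simpa using hxy)
  simpa using key

/-- If every group in the class `C` is commutative transitive, then every fully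
residually-`C` group is commutative transitive. -/
theorem commTrans_of_fully_residually (C : (H : Type) → Group H → Prop)
    (hC : ∀ (H : Type) (instH : Group H), C H instH →
      ∀ g h f : H, g ≠ 1 → h ≠ 1 → f ≠ 1 →
        g * h = h * g → g * f = f * g → h * f = f * h)
    (G : Type) [Group G]
    (hfr : ∀ (n : ℕ) (g : Fin n → G), Function.Injective g →
      ∃ (H : Type) (instH : Group H) (φ : G →* H), C H instH ∧ Function.Injective (φ ∘ g)) :
    ∀ g h f : G, g ≠ 1 → h ≠ 1 → f ≠ 1 →
      g * h = h * g → g * f = f * g → h * f = f * h := by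
  classical
  intro g h f hg hh hf hgh hgf
  obtain ⟨H, instH, φ, hH, hφ⟩ :=
    exists_monoidHom_injOn_finset C G hfr {1, g, h, f, h * f, f * h}
  have hne : ∀ x ∈ ({1, g, h, f, h * f, f * h} : Finset G), x ≠ 1 → φ x ≠ 1 :=
    fun x hx hx1 hφx => hx1 (hφ hx (by simp) (hφx.trans φ.map_one.symm))
  refine hφ (by simp) (by simp) ?_
  rw [map_mul, map_mul]
  refine hC H instH hH (φ g) (φ h) (φ f) (hne g (by simp) hg) (hne h (by simp) hh)
    (hne f (by simp) hf) ?_ ?_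
  · rw [← map_mul, hgh, map_mul]
  · rw [← map_mul, hgf, map_mul]
end

section
/- Let C be a class of groups with the property that for every group H in C and every non-abelian subgroup K of H, every abelian subgroup of K that is normal in K is trivial. If a group G is residually-C, then every abelian normal subgroup of G is contained in the centre of G. -/
/-- Suppose that in every group of the class `C`, every abelian subgroup of a
non-abelian subgroup `K` that is normal in `K` is trivial. Then every abelian
normal subgroup of a residually-`C` group is contained in its centre. -/
theorem abelian_normal_le_center_of_residually (C : (H : Type) → Group H → Prop)
    (hC : ∀ (H : Type) (instH : Group H), C H instH →
      ∀ K : Subgroup H, (∃ a ∈ K, ∃ b ∈ K, a * b ≠ b * a) →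
        ∀ A : Subgroup H, A ≤ K → (∀ a ∈ A, ∀ b ∈ A, a * b = b * a) →
          (∀ k ∈ K, ∀ a ∈ A, k * a * k⁻¹ ∈ A) → A = ⊥)
    (G : Type) [Group G]
    (hres : ∀ g : G, g ≠ 1 →
      ∃ (H : Type) (instH : Group H) (φ : G →* H), C H instH ∧ φ g ≠ 1) :
    ∀ A : Subgroup G, A.Normal → (∀ a ∈ A, ∀ b ∈ A, a * b = b * a) →
      A ≤ Subgroup.center G := by
  intro A hA hcomm a ha
  refine Subgroup.mem_center_iff.mpr fun g => ?_
  by_contra hga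
  have hne : g * a * (a * g)⁻¹ ≠ 1 := fun h => hga (mul_inv_eq_one.mp h)
  obtain ⟨H, instH, φ, hH, hφ⟩ := hres _ hne
  have hφga : φ g * φ a ≠ φ a * φ g := fun h => hφ (by simp [map_mul, h])
  have hbot : A.map φ = ⊥ := by
    refine hC H instH hH φ.range ⟨φ g, ⟨g, rfl⟩, φ a, ⟨a, rfl⟩, hφga⟩ (A.map φ)
      (Subgroup.map_le_range φ A) ?_ ?_
    · rintro _ ⟨x, hx, rfl⟩ _ ⟨y, hy, rfl⟩
      rw [← map_mul, ← map_mul, hcomm x hx y hy]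
    · rintro _ ⟨k, rfl⟩ _ ⟨x, hx, rfl⟩
      exact ⟨k * x * k⁻¹, hA.conj_mem x hx k, by simp⟩
  have hφa : φ a = 1 :=
    Subgroup.mem_bot.mp (hbot ▸ Subgroup.mem_map_of_mem φ ha)
  exact hφga (by simp [hφa])
end

section
/- Let G be a commutative transitive group in which every abelian normal subgroup is trivial. Then for every finite list of nontrivial elements g₁, ..., gₙ of G there exists a nontrivial element g of G such that for every group H and every group homomorphism φ : G → H, if φ(g) ≠ 1 then φ(gᵢ) ≠ 1 for all i = 1, ..., n. -/
/-- Two nontrivial normal subgroups of a commutative transitive group without nontrivial abelian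
normal subgroups intersect nontrivially. -/
theorem inf_ne_bot_of_commutative_transitive {G : Type*} [Group G]
    (hct : ∀ g h f : G, g ≠ 1 → h ≠ 1 → f ≠ 1 →
      g * h = h * g → g * f = f * g → h * f = f * h)
    (htriv : ∀ A : Subgroup G, A.Normal → (∀ a ∈ A, ∀ b ∈ A, a * b = b * a) → A = ⊥)
    {M N : Subgroup G} (hM : M.Normal) (hN : N.Normal) (hM' : M ≠ ⊥) (hN' : N ≠ ⊥) :
    M ⊓ N ≠ ⊥ := by
  intro hMN
  obtain ⟨⟨a, haM⟩, ha⟩ := Subgroup.ne_bot_iff_exists_ne_one.mp hM'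
  have hcomm : ∀ b ∈ N, a * b = b * a := fun b hb =>
    Subgroup.commute_of_normal_of_disjoint M N hM hN (disjoint_iff.mpr hMN) a b haM hb
  refine hN' (htriv N hN fun b hb c hc => ?_)
  by_cases hb1 : b = 1
  · simp [hb1]
  by_cases hc1 : c = 1
  · simp [hc1]
  exact hct a b c (fun h => ha (Subtype.ext h)) hb1 hc1 (hcomm b hb) (hcomm c hc)

/-- In a nontrivial commutative transitive group without nontrivial abelian normal subgroups,
finitely many nontrivial normal subgroups intersect nontrivially. -/
theorem finset_inf_ne_bot_of_commutative_transitive {G ι : Type*} [Group G] [Nontrivial G]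
    (hct : ∀ g h f : G, g ≠ 1 → h ≠ 1 → f ≠ 1 →
      g * h = h * g → g * f = f * g → h * f = f * h)
    (htriv : ∀ A : Subgroup G, A.Normal → (∀ a ∈ A, ∀ b ∈ A, a * b = b * a) → A = ⊥)
    (s : Finset ι) (N : ι → Subgroup G) (hN : ∀ i, (N i).Normal) (hN' : ∀ i, N i ≠ ⊥) :
    s.inf N ≠ ⊥ := by
  suffices h : (s.inf N).Normal ∧ s.inf N ≠ ⊥ from h.2
  refine Finset.inf_induction (p := fun K : Subgroup G => K.Normal ∧ K ≠ ⊥)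
    ⟨inferInstance, top_ne_bot⟩ ?_ fun i _ => ⟨hN i, hN' i⟩
  rintro K ⟨hK, hK'⟩ L ⟨hL, hL'⟩
  exact ⟨Subgroup.normal_inf_normal K L,
    inf_ne_bot_of_commutative_transitive hct htriv hK hL hK' hL'⟩

/-- B. Baumslag's claim: in a commutative transitive group all of whose abelian
normal subgroups are trivial, for every finite list of nontrivial elements
`g₁, …, gₙ` there is a nontrivial `g₀` such that any homomorphism not killing
`g₀` kills none of the `gᵢ`. -/
theorem exists_test_element (G : Type) [Group G]
    (hct : ∀ g h f : G, g ≠ 1 → h ≠ 1 → f ≠ 1 →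
      g * h = h * g → g * f = f * g → h * f = f * h)
    (htriv : ∀ A : Subgroup G, A.Normal → (∀ a ∈ A, ∀ b ∈ A, a * b = b * a) → A = ⊥)
    (n : ℕ) (hn : 0 < n) (g : Fin n → G) (hg : ∀ i, g i ≠ 1) :
    ∃ g₀ : G, g₀ ≠ 1 ∧
      ∀ (H : Type) (instH : Group H) (φ : G →* H), φ g₀ ≠ 1 → ∀ i, φ (g i) ≠ 1 := by
  have : Nontrivial G := ⟨g ⟨0, hn⟩, 1, hg _⟩
  have hne := finset_inf_ne_bot_of_commutative_transitive hct htriv Finset.univ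
    (fun i => Subgroup.normalClosure {g i}) (fun _ => Subgroup.normalClosure_normal)
    fun i h => hg i <| Subgroup.mem_bot.mp <|
      h ▸ Subgroup.subset_normalClosure (Set.mem_singleton (g i))
  obtain ⟨g₀, hg₀⟩ := Subgroup.ne_bot_iff_exists_ne_one.mp hne
  refine ⟨g₀, fun h => hg₀ (Subtype.ext h), fun H instH φ hφ i hi => hφ ?_⟩
  have hle : Subgroup.normalClosure {g i} ≤ φ.ker :=
    Subgroup.normalClosure_le_normal (Set.singleton_subset_iff.mpr hi)
  exact hle (Finset.inf_le (f := fun i => Subgroup.normalClosure {g i}) (Finset.mem_univ i) g₀.2)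
end

section
/- Let C be a class of groups with the property that for every group H in C and every non-abelian subgroup K of H, every abelian subgroup of K that is normal in K is trivial. Let G be a finitely generated non-abelian group that is residually-C and commutative transitive. Then G is fully residually-C. -/
open scoped commutatorElement

/-- If `G` is non-abelian, commutative transitive and residually-`C`, where non-abelian subgroups
of groups of the class `C` have no nontrivial abelian normal subgroups, then neither has `G`. -/
theorem eq_bot_of_abelian_normal_of_residually (C : (H : Type) → Group H → Prop)
    (hC : ∀ (H : Type) (instH : Group H), C H instH →
      ∀ K : Subgroup H, (∃ a ∈ K, ∃ b ∈ K, a * b ≠ b * a) →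
        ∀ A : Subgroup H, A ≤ K → (∀ a ∈ A, ∀ b ∈ A, a * b = b * a) →
          (∀ k ∈ K, ∀ a ∈ A, k * a * k⁻¹ ∈ A) → A = ⊥)
    {G : Type*} [Group G] (hna : ∃ a b : G, a * b ≠ b * a)
    (hres : ∀ g : G, g ≠ 1 →
      ∃ (H : Type) (instH : Group H) (φ : G →* H), C H instH ∧ φ g ≠ 1)
    (hct : ∀ g h f : G, g ≠ 1 → h ≠ 1 → f ≠ 1 →
      g * h = h * g → g * f = f * g → h * f = f * h)
    (A : Subgroup G) [hA : A.Normal] (hcomm : ∀ a ∈ A, ∀ b ∈ A, a * b = b * a) :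
    A = ⊥ := by
  have central : ∀ b ∈ A, ∀ t : G, b * t = t * b := by
    intro b hb t
    by_contra hbt
    have hx : ⁅b, t⁆ ≠ 1 := fun h => hbt (commutatorElement_eq_one_iff_mul_comm.1 h)
    have hxA : ⁅b, t⁆ ∈ A := by
      have := A.mul_mem hb (hA.conj_mem _ (A.inv_mem hb) t)
      simpa [commutatorElement_def, mul_assoc] using this
    obtain ⟨H, instH, φ, hH, hφ⟩ := hres _ hx
    have hbot : A.map φ = ⊥ := by
      refine hC H instH hH φ.range ⟨φ b, ⟨b, rfl⟩, φ t, ⟨t, rfl⟩, fun h => hφ ?_⟩ (A.map φ)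
        (A.map_le_range φ) ?_ ?_
      · rw [map_commutatorElement, commutatorElement_eq_one_iff_mul_comm, h]
      · rintro _ ⟨x, hx, rfl⟩ _ ⟨y, hy, rfl⟩
        rw [← map_mul, hcomm x hx y hy, map_mul]
      · rintro _ ⟨k, rfl⟩ _ ⟨x, hx, rfl⟩
        exact ⟨k * x * k⁻¹, hA.conj_mem x hx k, by simp⟩
    exact hφ (Subgroup.mem_bot.1 (hbot ▸ Subgroup.mem_map_of_mem φ hxA))
  refine (Subgroup.eq_bot_iff_forall A).2 fun b hb => ?_
  by_contra hb1
  obtain ⟨x, y, hxy⟩ := hna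
  have hx : x ≠ 1 := by rintro rfl; simp at hxy
  have hy : y ≠ 1 := by rintro rfl; simp at hxy
  exact hxy (hct b x y hb1 hx hy (central b hb x) (central b hb y))

/-- In a commutative transitive group without nontrivial abelian normal subgroups, no nontrivial
element commutes with all conjugates of a nontrivial element. -/
theorem exists_mul_conj_ne_of_commTrans {G : Type*} [Group G]
    (hct : ∀ g h f : G, g ≠ 1 → h ≠ 1 → f ≠ 1 →
      g * h = h * g → g * f = f * g → h * f = f * h)
    (hG : ∀ A : Subgroup G, A.Normal → (∀ a ∈ A, ∀ b ∈ A, a * b = b * a) → A = ⊥)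
    {a b : G} (ha : a ≠ 1) (hb : b ≠ 1) :
    ∃ t : G, a * (t * b * t⁻¹) ≠ t * b * t⁻¹ * a := by
  by_contra! h
  have hle : Subgroup.normalClosure {b} ≤ Subgroup.centralizer {a} := by
    rw [Subgroup.normalClosure, Subgroup.closure_le]
    intro x hx
    obtain ⟨c, rfl, hc⟩ := Group.mem_conjugatesOfSet_iff.1 hx
    obtain ⟨t, rfl⟩ := isConj_iff.1 hc
    exact Subgroup.mem_centralizer_singleton_iff.2 (h t).symm
  have hbot := hG (Subgroup.normalClosure {b}) inferInstance fun x hx y hy => by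
    by_cases hx1 : x = 1
    · simp [hx1]
    by_cases hy1 : y = 1
    · simp [hy1]
    exact hct a x y ha hx1 hy1 (Subgroup.mem_centralizer_singleton_iff.1 (hle hx)).symm
      (Subgroup.mem_centralizer_singleton_iff.1 (hle hy)).symm
  exact hb (Subgroup.mem_bot.1 (hbot ▸ Subgroup.subset_normalClosure rfl))

/-- In a nontrivial commutative transitive group without nontrivial abelian normal subgroups, the
normal closures of finitely many nontrivial elements intersect nontrivially. -/
theorem exists_ne_one_mem_normalClosure_of_commTrans {G : Type*} [Group G] [Nontrivial G]
    (hct : ∀ g h f : G, g ≠ 1 → h ≠ 1 → f ≠ 1 →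
      g * h = h * g → g * f = f * g → h * f = f * h)
    (hG : ∀ A : Subgroup G, A.Normal → (∀ a ∈ A, ∀ b ∈ A, a * b = b * a) → A = ⊥)
    {S : Set G} (hS : S.Finite) (h1 : 1 ∉ S) :
    ∃ w : G, w ≠ 1 ∧ ∀ s ∈ S, w ∈ Subgroup.normalClosure {s} := by
  induction S, hS using Set.Finite.induction_on with
  | empty =>
    obtain ⟨w, hw⟩ := exists_ne (1 : G)
    exact ⟨w, hw, by simp⟩
  | @insert s S _ _ ih =>
    obtain ⟨w, hw, hwS⟩ := ih fun h => h1 (Set.mem_insert_of_mem s h)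
    have hs : s ≠ 1 := fun h => h1 (h ▸ Set.mem_insert s S)
    obtain ⟨t, ht⟩ := exists_mul_conj_ne_of_commTrans hct hG hw hs
    refine ⟨⁅w, t * s * t⁻¹⁆, fun h => ht (commutatorElement_eq_one_iff_mul_comm.1 h), ?_⟩
    rintro r (rfl | hr)
    · have hmem := Subgroup.normalClosure_normal.conj_mem r
        (Subgroup.subset_normalClosure (Set.mem_singleton r)) t
      exact mul_mem (Subgroup.normalClosure_normal.conj_mem _ hmem w) (inv_mem hmem)
    · have := mul_mem (hwS r hr)
        (Subgroup.normalClosure_normal.conj_mem _ (inv_mem (hwS r hr)) (t * s * t⁻¹))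
      simpa only [commutatorElement_def, mul_assoc] using this

/-- Suppose that in every group of the class `C`, every abelian subgroup of a
non-abelian subgroup `K` that is normal in `K` is trivial. Then every finitely
generated non-abelian group that is residually-`C` and commutative transitive is
fully residually-`C`. -/
theorem fully_residually_of_residually_commTrans (C : (H : Type) → Group H → Prop)
    (hC : ∀ (H : Type) (instH : Group H), C H instH →
      ∀ K : Subgroup H, (∃ a ∈ K, ∃ b ∈ K, a * b ≠ b * a) →
        ∀ A : Subgroup H, A ≤ K → (∀ a ∈ A, ∀ b ∈ A, a * b = b * a) →
          (∀ k ∈ K, ∀ a ∈ A, k * a * k⁻¹ ∈ A) → A = ⊥)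
    (G : Type) [Group G] (hfg : Group.FG G)
    (hna : ∃ a b : G, a * b ≠ b * a)
    (hres : ∀ g : G, g ≠ 1 →
      ∃ (H : Type) (instH : Group H) (φ : G →* H), C H instH ∧ φ g ≠ 1)
    (hct : ∀ g h f : G, g ≠ 1 → h ≠ 1 → f ≠ 1 →
      g * h = h * g → g * f = f * g → h * f = f * h) :
    ∀ (n : ℕ) (g : Fin n → G), Function.Injective g →
      ∃ (H : Type) (instH : Group H) (φ : G →* H),
        C H instH ∧ Function.Injective (φ ∘ g) := by
  intro n g hg
  have hG : ∀ A : Subgroup G, A.Normal → (∀ a ∈ A, ∀ b ∈ A, a * b = b * a) → A = ⊥ :=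
    fun A _ => eq_bot_of_abelian_normal_of_residually C hC hna hres hct A
  obtain ⟨a, b, hab⟩ := hna
  have : Nontrivial G := ⟨_, _, hab⟩
  let d : {p : Fin n × Fin n // p.1 ≠ p.2} → G := fun p => g p.1.1 * (g p.1.2)⁻¹
  have hd : 1 ∉ Set.range d := by
    rintro ⟨p, hp⟩
    exact p.2 (hg (mul_inv_eq_one.1 hp))
  obtain ⟨w, hw, hwd⟩ :=
    exists_ne_one_mem_normalClosure_of_commTrans hct hG (Set.finite_range d) hd
  obtain ⟨H, instH, φ, hH, hφ⟩ := hres w hw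
  refine ⟨H, instH, φ, hH, fun i j hij => ?_⟩
  by_contra hne
  have hker : d ⟨(i, j), hne⟩ ∈ φ.ker := by
    rw [MonoidHom.mem_ker, map_mul, map_inv, mul_inv_eq_one]
    exact hij
  exact hφ (Subgroup.normalClosure_le_normal (Set.singleton_subset_iff.2 hker)
    (hwd _ (Set.mem_range_self _)))
end

section
/- Let p be a nonzero integer and let ε = 1 or ε = -1. In the Baumslag–Solitar group BS(p, εp) = ⟨a, b ∣ b a^p b⁻¹ = a^{εp}⟩, the subgroup generated by a^p and b² is free abelian of rank 2, i.e., isomorphic to ℤ × ℤ. -/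
/-- The single defining relator `b * a^p * b⁻¹ * a^(-q)` of the Baumslag–Solitar
group `BS(p,q)`, inside the free group on two generators `a = of 0`, `b = of 1`. -/
def BSRel (p q : ℤ) : Set (FreeGroup (Fin 2)) :=
  {FreeGroup.of 1 * (FreeGroup.of 0) ^ p * (FreeGroup.of 1)⁻¹ * (FreeGroup.of 0) ^ (-q)}

/-- The Baumslag–Solitar group `BS(p,q) = ⟨a, b ∣ b a^p b⁻¹ = a^q⟩`. -/
abbrev BS (p q : ℤ) : Type := PresentedGroup (BSRel p q)

/-- Two commuting elements without nontrivial relations generate a copy of `ℤ × ℤ`. -/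
theorem Commute.nonempty_closure_pair_mulEquiv {G : Type*} [Group G] {x y : G} (h : Commute x y)
    (hxy : ∀ m n : ℤ, x ^ m * y ^ n = 1 → m = 0 ∧ n = 0) :
    Nonempty (Subgroup.closure {x, y} ≃* Multiplicative (ℤ × ℤ)) := by
  let f : Multiplicative (ℤ × ℤ) →* G :=
    { toFun := fun v => x ^ v.toAdd.1 * y ^ v.toAdd.2
      map_one' := by simp
      map_mul' := fun v w => by
        simp only [toAdd_mul, Prod.fst_add, Prod.snd_add, zpow_add]
        exact (h.zpow_zpow w.toAdd.1 v.toAdd.2).mul_mul_mul_comm _ _ }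
  have hf : Function.Injective f := by
    refine (injective_iff_map_eq_one f).2 fun v hv => ?_
    obtain ⟨h₁, h₂⟩ := hxy _ _ hv
    exact Multiplicative.toAdd.injective (Prod.ext h₁ h₂)
  have hrange : f.range = Subgroup.closure {x, y} := by
    apply le_antisymm
    · rintro _ ⟨v, rfl⟩
      exact mul_mem (zpow_mem (Subgroup.subset_closure (by simp)) _)
        (zpow_mem (Subgroup.subset_closure (by simp)) _)
    · rw [Subgroup.closure_le]
      rintro z (rfl | rfl)
      · exact ⟨Multiplicative.ofAdd (1, 0), by simp [f]⟩
      · exact ⟨Multiplicative.ofAdd (0, 1), by simp [f]⟩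
  exact ⟨((MonoidHom.ofInjective hf).trans (MulEquiv.subgroupCongr hrange)).symm⟩

theorem BS.semiconjBy (p q : ℤ) :
    SemiconjBy (PresentedGroup.of 1 : BS p q) (PresentedGroup.of 0 ^ p)
      (PresentedGroup.of 0 ^ q) := by
  have h : PresentedGroup.mk (BSRel p q) (FreeGroup.of 1 * (FreeGroup.of 0) ^ p *
      (FreeGroup.of 1)⁻¹ * (FreeGroup.of 0) ^ (-q)) = 1 :=
    PresentedGroup.one_of_mem (Set.mem_singleton _)
  simp only [map_mul, map_zpow, map_inv, zpow_neg] at h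
  exact mul_inv_eq_iff_eq_mul.1 (mul_inv_eq_one.1 h)

theorem BS.commute_zpow_sq (p ε : ℤ) (hε : ε * ε = 1) :
    Commute ((PresentedGroup.of 0 : BS p (ε * p)) ^ p) (PresentedGroup.of 1 ^ 2) := by
  have h := BS.semiconjBy p (ε * p)
  have h' := h.zpow_right ε
  rw [← zpow_mul, ← zpow_mul, mul_comm p ε, mul_right_comm, hε, one_mul] at h'
  rw [pow_two]
  exact (h'.mul_left h).symm

/-- The translation `(x, y) ↦ (x + 1, y)` of the lattice. -/
def latticeShift : Equiv.Perm (ℤ × ℤ) :=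
  (Equiv.addRight 1).prodCongr (Equiv.refl ℤ)

/-- The glide `(x, y) ↦ (ε x, y + 1)` of the lattice. -/
def latticeGlide (ε : ℤˣ) : Equiv.Perm (ℤ × ℤ) :=
  (Units.mulLeft ε).prodCongr (Equiv.addRight 1)

theorem latticeShift_zpow_apply (n : ℤ) (v : ℤ × ℤ) :
    (latticeShift ^ n) v = (v.1 + n, v.2) := by
  induction n generalizing v with
  | zero => simp
  | succ n ih => rw [zpow_add_one, Equiv.Perm.mul_apply, ih]; simp [latticeShift]; ring
  | pred n ih => rw [zpow_sub_one, Equiv.Perm.mul_apply, ih]; simp [latticeShift, Equiv.Perm.inv_def]; ring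

theorem latticeGlide_zpow_apply_snd (ε : ℤˣ) (n : ℤ) (v : ℤ × ℤ) :
    ((latticeGlide ε ^ n) v).2 = v.2 + n := by
  induction n generalizing v with
  | zero => simp
  | succ n ih => rw [zpow_add_one, Equiv.Perm.mul_apply, ih]; simp [latticeGlide]; ring
  | pred n ih => rw [zpow_sub_one, Equiv.Perm.mul_apply, ih]; simp [latticeGlide, Equiv.Perm.inv_def]; ring

/-- The action of `BS(p, εp)` on the lattice by shifts and glides. -/
def BS.latticeAction (p : ℤ) (ε : ℤˣ) : BS p (ε * p) →* Equiv.Perm (ℤ × ℤ) :=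
  PresentedGroup.toGroup (f := ![latticeShift, latticeGlide ε]) (by
    rintro _ rfl
    simp only [map_mul, map_zpow, map_inv, FreeGroup.lift_apply_of, zpow_neg]
    rw [mul_inv_eq_one, mul_inv_eq_iff_eq_mul]
    ext v <;>
      simp [latticeShift_zpow_apply, latticeGlide, mul_add])

theorem BS.zpow_mul_zpow_eq_one (p : ℤ) (hp : p ≠ 0) (ε : ℤˣ) (m n : ℤ)
    (h : ((PresentedGroup.of 0 : BS p (ε * p)) ^ p) ^ m * (PresentedGroup.of 1 ^ 2) ^ n = 1) :
    m = 0 ∧ n = 0 := by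
  have h₁ := congrArg (BS.latticeAction p ε) h
  have h₀ : (latticeShift ^ p) ^ m * (latticeGlide ε ^ 2) ^ n = 1 := by
    simpa [BS.latticeAction] using h₁
  rw [← zpow_mul, ← zpow_natCast, ← zpow_mul] at h₀
  have hn : n = 0 := by
    have := congrArg (fun g : Equiv.Perm (ℤ × ℤ) => (g 0).2) h₀
    simpa [latticeShift_zpow_apply, latticeGlide_zpow_apply_snd] using this
  subst hn
  have := congrArg (fun g : Equiv.Perm (ℤ × ℤ) => (g 0).1) h₀
  simpa [latticeShift_zpow_apply, hp] using this

/-- In `BS(p, εp)` with `p ≠ 0` and `ε = ±1`, the subgroup generated by `a^p`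
and `b²` is free abelian of rank 2, i.e. isomorphic to `ℤ × ℤ`. -/
theorem BS_subgroup_free_abelian_rank_two (p : ℤ) (hp : p ≠ 0)
    (ε : ℤ) (hε : ε = 1 ∨ ε = -1) :
    Nonempty
      ((Subgroup.closure
        {(PresentedGroup.of 0 : BS p (ε * p)) ^ p,
         (PresentedGroup.of 1 : BS p (ε * p)) ^ (2 : ℕ)}) ≃* Multiplicative (ℤ × ℤ)) := by
  obtain ⟨u, rfl⟩ := Int.isUnit_iff.2 hε
  exact (BS.commute_zpow_sq p u (by simp [← Units.val_mul])).nonempty_closure_pair_mulEquiv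
    (BS.zpow_mul_zpow_eq_one p hp u)
end

section
/- For every integer q ≥ 2, the Baumslag–Solitar group BS(1,q) = ⟨a, b ∣ b a b⁻¹ = a^q⟩ is fully residually finite: for every finite list of pairwise distinct elements g₁, ..., gₙ of BS(1,q) there exist a finite group K and a group homomorphism ψ : BS(1,q) → K such that ψ(g₁), ..., ψ(gₙ) are pairwise distinct. -/
/-- If `b * a * b⁻¹ = a ^ q`, then every `x` in the subgroup generated by `a` and `b` has the form
`x = b⁻ᵏ * a ^ m * b ^ l` with `k` and `l` natural numbers. -/
theorem exists_pow_mul_eq_zpow_mul_pow {G : Type*} [Group G] {a b : G} {q : ℤ}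
    (h : SemiconjBy b a (a ^ q)) {x : G} (hx : x ∈ Subgroup.closure {a, b}) :
    ∃ (k l : ℕ) (m : ℤ), b ^ k * x = a ^ m * b ^ l := by
  have hb (m : ℤ) : b * a ^ m = a ^ (q * m) * b := by
    rw [zpow_mul]
    exact (h.zpow_right m).eq
  have hbk (k : ℕ) (m : ℤ) : b ^ k * a ^ m = a ^ (q ^ k * m) * b ^ k := by
    induction k generalizing m with
    | zero => simp
    | succ k ih => rw [pow_succ, mul_assoc, hb, ← mul_assoc, ih, mul_assoc, pow_succ, mul_assoc]
  have ha (e : ℤ) (y : G) (hy : ∃ (k l : ℕ) (m : ℤ), b ^ k * y = a ^ m * b ^ l) :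
      ∃ (k l : ℕ) (m : ℤ), b ^ k * (a ^ e * y) = a ^ m * b ^ l := by
    obtain ⟨k, l, m, hm⟩ := hy
    exact ⟨k, l, q ^ k * e + m, by rw [← mul_assoc, hbk, mul_assoc, hm, zpow_add, mul_assoc]⟩
  induction hx using Subgroup.closure_induction_left with
  | one => exact ⟨0, 0, 0, by simp⟩
  | mul_left s hs y _ ih =>
    obtain rfl | rfl := hs
    · simpa using ha 1 y ih
    · obtain ⟨k, l, m, hm⟩ := ih
      refine ⟨k, l + 1, q * m, ?_⟩
      rw [← mul_assoc, ← pow_succ, pow_succ', mul_assoc, hm, ← mul_assoc, hb, mul_assoc, pow_succ']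
  | inv_mul_cancel s hs y _ ih =>
    obtain rfl | rfl := hs
    · simpa using ha (-1) y ih
    · obtain ⟨k, l, m, hm⟩ := ih
      exact ⟨k + 1, l, m, by rw [pow_succ, mul_assoc, mul_inv_cancel_left, hm]⟩

namespace BS

variable {q : ℤ}

/-- The homomorphism from `BS(1,q)` given by a pair of elements satisfying the relation. -/
def lift {K : Type*} [Group K] (α β : K) (h : β * α * β⁻¹ = α ^ q) : BS 1 q →* K :=
  PresentedGroup.toGroup (f := ![α, β]) (by
    rintro r rfl
    simp [h])

@[simp] theorem lift_of_zero {K : Type*} [Group K] (α β : K) (h : β * α * β⁻¹ = α ^ q) :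
    lift α β h (PresentedGroup.of 0) = α := by
  simp [lift]

@[simp] theorem lift_of_one {K : Type*} [Group K] (α β : K) (h : β * α * β⁻¹ = α ^ q) :
    lift α β h (PresentedGroup.of 1) = β := by
  simp [lift]

theorem semiconjBy_of :
    SemiconjBy (PresentedGroup.of 1 : BS 1 q) (PresentedGroup.of 0)
      (PresentedGroup.of 0 ^ q) := by
  have h : (PresentedGroup.of 1 : BS 1 q) * PresentedGroup.of 0 ^ (1 : ℤ) *
      (PresentedGroup.of 1)⁻¹ * PresentedGroup.of 0 ^ (-q) = 1 :=
    PresentedGroup.one_of_mem (rels := BSRel 1 q) rfl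
  rw [zpow_one, zpow_neg, mul_inv_eq_one] at h
  exact mul_inv_eq_iff_eq_mul.mp h

/-- Every element of `BS(1,q)` has the form `b⁻ᵏ * a ^ m * b ^ l` with `k` and `l` natural numbers. -/
theorem exists_normal_form (x : BS 1 q) :
    ∃ (k l : ℕ) (m : ℤ), PresentedGroup.of 1 ^ k * x =
      PresentedGroup.of 0 ^ m * PresentedGroup.of 1 ^ l := by
  refine exists_pow_mul_eq_zpow_mul_pow semiconjBy_of ?_
  have h := PresentedGroup.closure_range_of (BSRel 1 q)
  have hr : Set.range (PresentedGroup.of (rels := BSRel 1 q)) =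
      {PresentedGroup.of 0, PresentedGroup.of 1} := by
    ext y
    simp [Fin.exists_fin_two, eq_comm]
  rw [← hr, h]
  exact Subgroup.mem_top x

/-- Modulo an integer `N` coprime to `q`, the group `BS(1,q)` acts on `ZMod N` by affine maps,
`a` acting as `x ↦ x + 1` and `b` as `x ↦ q * x`. -/
theorem exists_affine_action {N : ℕ} (hN : IsUnit (q : ZMod N)) :
    ∃ ψ : BS 1 q →* Equiv.Perm (ZMod N),
      ∀ m : ℤ, ψ (PresentedGroup.of 0 ^ m) 0 = (m : ZMod N) := by
  obtain ⟨u, hu⟩ := hN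
  have hpow (m : ℤ) : Equiv.addLeft (1 : ZMod N) ^ m = Equiv.addLeft (m : ZMod N) := by
    simp
  refine ⟨lift (Equiv.addLeft 1) (Units.mulLeft u) ?_, fun m ↦ ?_⟩
  · rw [mul_inv_eq_iff_eq_mul, hpow]
    ext x
    simp [hu, mul_add]
  · rw [map_zpow, lift_of_zero, hpow]
    simp

/-- For `q ≠ 0`, the group `BS(1,q)` is residually finite. -/
theorem exists_finite_quotient_ne_one (hq : q ≠ 0) (x : BS 1 q) (hx : x ≠ 1) :
    ∃ (K : Type) (_ : Group K) (_ : Finite K) (ψ : BS 1 q →* K), ψ x ≠ 1 := by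
  obtain ⟨k, l, m, h⟩ := exists_normal_form x
  by_cases hkl : k = l
  · subst hkl
    have hm : m ≠ 0 := by
      rintro rfl
      simp_all
    set N := m.natAbs * q.natAbs + 1 with hN
    have hunit : IsUnit (q : ZMod N) := by
      rw [ZMod.coe_int_isUnit_iff_isCoprime, Int.isCoprime_iff_gcd_eq_one, Int.gcd,
        Int.natAbs_natCast, hN]
      simp
    obtain ⟨ψ, hψ⟩ := exists_affine_action hunit
    refine ⟨Equiv.Perm (ZMod N), inferInstance, inferInstance, ψ, fun h1 ↦ ?_⟩
    have h2 := congrArg ψ h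
    rw [map_mul, map_mul, h1, mul_one, right_eq_mul] at h2
    have h3 := hψ m
    rw [h2, Equiv.Perm.one_apply, eq_comm, ZMod.intCast_zmod_eq_zero_iff_dvd] at h3
    refine hm (Int.eq_zero_of_dvd_of_natAbs_lt_natAbs h3 ?_)
    rw [Int.natAbs_natCast, hN]
    exact Nat.lt_succ_of_le (Nat.le_mul_of_pos_right _ (Int.natAbs_pos.mpr hq))
  · have : NeZero (k + l + 1) := ⟨by omega⟩
    refine ⟨Multiplicative (ZMod (k + l + 1)), inferInstance, inferInstance,
      lift 1 (Multiplicative.ofAdd 1) (by simp), fun h1 ↦ hkl ?_⟩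
    have h2 := congrArg (lift (q := q) 1 (Multiplicative.ofAdd (1 : ZMod (k + l + 1))) (by simp)) h
    rw [map_mul, map_mul, h1] at h2
    simp only [map_pow, map_zpow, lift_of_zero, lift_of_one, one_zpow, one_mul, mul_one,
      ← ofAdd_nsmul, nsmul_one, EmbeddingLike.apply_eq_iff_eq] at h2
    rw [ZMod.natCast_eq_natCast_iff'] at h2
    rwa [Nat.mod_eq_of_lt (by omega), Nat.mod_eq_of_lt (by omega)] at h2

end BS

/-- For `q ≥ 2`, the Baumslag–Solitar group `BS(1,q)` is fully residually finite. -/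
theorem BS_one_q_fully_residually_finite (q : ℤ) (hq : 2 ≤ q) :
    ∀ (n : ℕ) (g : Fin n → BS 1 q), Function.Injective g →
      ∃ (K : Type) (_ : Group K) (_ : Finite K) (ψ : BS 1 q →* K),
        Function.Injective (ψ ∘ g) := by
  intro n g hg
  choose K hK hfin ψ hψ using fun p : {p : Fin n × Fin n // p.1 ≠ p.2} ↦
    BS.exists_finite_quotient_ne_one (by omega) (g p.1.1 * (g p.1.2)⁻¹)
      (mul_inv_eq_one.not.mpr (hg.ne p.2))
  refine ⟨∀ p, K p, inferInstance, inferInstance, MonoidHom.pi ψ, fun i j hij ↦ ?_⟩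
  by_contra hne
  refine hψ ⟨(i, j), hne⟩ ?_
  rw [map_mul, map_inv, mul_inv_eq_one]
  exact congrFun hij ⟨(i, j), hne⟩
end

section
/- Let G be a torsion-free group that contains a cyclic subgroup of finite index (i.e., G is torsion-free and virtually cyclic). Then G is cyclic; more precisely, G is either trivial or isomorphic to the group of integers ℤ. -/
/-- In a torsion-free group, a cyclic normal subgroup of finite index is central. -/
theorem Subgroup.le_center_of_isCyclic_of_torsionFree {G : Type*} [Group G]
    (htf : ∀ g : G, IsOfFinOrder g → g = 1) (K : Subgroup G) [K.Normal] [IsCyclic K]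
    [K.FiniteIndex] : K ≤ Subgroup.center G := by
  obtain ⟨b, rfl⟩ := K.isCyclic_iff_exists_zpowers_eq_top.mp ‹_›
  rw [Subgroup.zpowers_le, Subgroup.mem_center_iff]
  intro g
  obtain ⟨k, hk⟩ := Subgroup.mem_zpowers_iff.mp
    (Subgroup.Normal.conj_mem ‹_› b (Subgroup.mem_zpowers b) g)
  obtain ⟨j, hj⟩ := Subgroup.mem_zpowers_iff.mp ((Subgroup.zpowers b).pow_index_mem g)
  by_cases hg : g = 1
  · simp [hg]
  have hj0 : j ≠ 0 := by
    rintro rfl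
    exact hg (htf g (isOfFinOrder_iff_pow_eq_one.mpr
      ⟨_, Nat.pos_of_ne_zero Subgroup.FiniteIndex.index_ne_zero, by simpa using hj.symm⟩))
  by_cases hb : b = 1
  · simp [hb]
  have hinj := injective_zpow_iff_not_isOfFinOrder.mpr fun h => hb (htf b h)
  have hconj : b ^ (k * j) = b ^ j := by
    rw [zpow_mul, hk, conj_zpow, hj, ← pow_succ', pow_succ, mul_inv_cancel_right]
  have hk1 : k = 1 := mul_right_cancel₀ hj0 ((hinj hconj).trans (one_mul j).symm)
  rw [hk1, zpow_one, eq_mul_inv_iff_mul_eq] at hk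
  exact hk.symm

/-- A torsion-free virtually cyclic group is cyclic. -/
theorem isCyclic_of_torsionFree_of_finiteIndex {G : Type*} [Group G]
    (htf : ∀ g : G, IsOfFinOrder g → g = 1) (H : Subgroup G) [IsCyclic H] [H.FiniteIndex] :
    IsCyclic G := by
  have hpow {g : G} {n : ℕ} (hn : n ≠ 0) (h : g ^ n = 1) : g = 1 :=
    htf g (isOfFinOrder_iff_pow_eq_one.mpr ⟨n, Nat.pos_of_ne_zero hn, h⟩)
  let K := H.normalCore
  have : IsCyclic K := Subgroup.isCyclic_of_le H.normalCore_le
  have : (Subgroup.center G).FiniteIndex :=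
    Subgroup.finiteIndex_of_le (K.le_center_of_isCyclic_of_torsionFree htf)
  let φ : Subgroup.center G →* K :=
    { toFun := fun z => ⟨(z : G) ^ K.index, K.pow_index_mem (z : G)⟩
      map_one' := Subtype.ext (one_pow _)
      map_mul' := fun y z => Subtype.ext
        (Commute.mul_pow (Subgroup.mem_center_iff.mp z.2 (y : G)) K.index) }
  have hφ : Function.Injective φ := by
    refine (injective_iff_map_eq_one φ).mpr fun z hz => Subtype.ext ?_
    exact hpow (n := K.index) Subgroup.FiniteIndex.index_ne_zero (congrArg Subtype.val hz)
  have hψ : Function.Injective (MonoidHom.transferCenterPow G) := by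
    refine (injective_iff_map_eq_one _).mpr fun g hg => ?_
    exact hpow Subgroup.FiniteIndex.index_ne_zero (congrArg Subtype.val hg)
  exact isCyclic_of_injective (φ.comp (MonoidHom.transferCenterPow G)) (hφ.comp hψ)

/-- A torsion-free group with a cyclic subgroup of finite index is either trivial
or isomorphic to `ℤ`. -/
theorem torsionFree_virtually_cyclic (G : Type) [Group G]
    (htf : ∀ g : G, IsOfFinOrder g → g = 1)
    (hvc : ∃ H : Subgroup G, IsCyclic H ∧ H.index ≠ 0) :
    (∀ g : G, g = 1) ∨ Nonempty (G ≃* Multiplicative ℤ) := by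
  obtain ⟨H, _, hH⟩ := hvc
  have : H.FiniteIndex := ⟨hH⟩
  have := isCyclic_of_torsionFree_of_finiteIndex htf H
  obtain ⟨a, ha⟩ := IsCyclic.exists_generator (α := G)
  by_cases ha1 : a = 1
  · subst ha1
    exact Or.inl fun g => by simpa using ha g
  · have hbij : Function.Bijective (zpowersHom G a) :=
      ⟨injective_zpow_iff_not_isOfFinOrder.mpr fun h => ha1 (htf a h), ha⟩
    exact Or.inr ⟨(MulEquiv.ofBijective (zpowersHom G a) hbij).symm⟩
end
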